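/- The function f is continuously differentiable with f'(r) = φ(r)g(r), twice differentiable on (0, R₁), and for every r ∈ (0, R₁) one has f'(r)·(a − m r) + (4/β)·f''(r) ≤ −(1/β)·[Φ(r)/(∫₀^{R₁} Φ(s)/φ(s) ds) + 1/(∫₀^{R₁} φ(s)^{−1} ds)]. In particular, with c = min{1/β, 1/2}·(∫₀^{R₁} Φ(s)/φ(s) ds)^{−1} and ε = min{Φ(R₁)·(2∫₀^{R₁} Φ(s)/φ(s) ds)^{−1}, (β∫₀^{R₁} φ(s)^{−1} ds)^{−1}}, one has f'(r)(a − m r) + (4/β)f''(r) ≤ −(ε + c·f(r)) for all r ∈ (0, R₁). -/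

import Mathlib

open MeasureTheory intervalIntegral

/-- The Eberle weight `φ(r) = exp(−(β/4)∫₀^r max{0, a − m s} ds)`. -/
noncomputable def eberlePhi (β a m r : ℝ) : ℝ :=
  Real.exp (-(β / 4) * ∫ s in (0:ℝ)..r, max 0 (a - m * s))

/-- `Φ(r) = ∫₀^r φ(s) ds`. -/
noncomputable def eberleCapPhi (β a m r : ℝ) : ℝ :=
  ∫ s in (0:ℝ)..r, eberlePhi β a m s

/-- `R₀ = a/m`. -/
noncomputable def eberleR0 (a m : ℝ) : ℝ := a / m

/-- `R₁ = a/m + 2/√m`. -/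
noncomputable def eberleR1 (a m : ℝ) : ℝ := a / m + 2 / Real.sqrt m

/-- `∫₀^{R₁} Φ(s)/φ(s) ds`. -/
noncomputable def eberleIntRatio (β a m : ℝ) : ℝ :=
  ∫ s in (0:ℝ)..(eberleR1 a m), eberleCapPhi β a m s / eberlePhi β a m s

/-- `∫₀^{R₁} φ(s)⁻¹ ds`. -/
noncomputable def eberleIntInv (β a m : ℝ) : ℝ :=
  ∫ s in (0:ℝ)..(eberleR1 a m), (eberlePhi β a m s)⁻¹

/-- The Eberle modulation function `g`. -/
noncomputable def eberleG (β a m r : ℝ) : ℝ :=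
  1 - (1 / 4) * (∫ s in (0:ℝ)..(min r (eberleR1 a m)),
        eberleCapPhi β a m s / eberlePhi β a m s) / eberleIntRatio β a m
    - (1 / 4) * (∫ s in (0:ℝ)..(min r (eberleR1 a m)),
        (eberlePhi β a m s)⁻¹) / eberleIntInv β a m

/-- The Eberle concave distance function `f(r) = ∫₀^r φ(s) g(s) ds`. -/
noncomputable def eberleF (β a m r : ℝ) : ℝ :=
  ∫ s in (0:ℝ)..r, eberlePhi β a m s * eberleG β a m s

/-- The contraction rate `c = min{1/β, 1/2} (∫₀^{R₁} Φ/φ)⁻¹`. -/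
noncomputable def eberleC (β a m : ℝ) : ℝ :=
  min (1 / β) (1 / 2) * (eberleIntRatio β a m)⁻¹

/-- The drift lower bound `ε = min{Φ(R₁)(2∫₀^{R₁} Φ/φ)⁻¹, (β∫₀^{R₁} φ⁻¹)⁻¹}`. -/
noncomputable def eberleEps (β a m : ℝ) : ℝ :=
  min (eberleCapPhi β a m (eberleR1 a m) * (2 * eberleIntRatio β a m)⁻¹)
    ((β * eberleIntInv β a m)⁻¹)

lemma hasDerivAt_integral_zero {u : ℝ → ℝ} (hu : Continuous u) (r : ℝ) :
    HasDerivAt (fun x => ∫ s in (0:ℝ)..x, u s) (u r) r :=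
  (hu.integral_hasStrictDerivAt 0 r).hasDerivAt

lemma continuous_integral_zero {u : ℝ → ℝ} (hu : Continuous u) :
    Continuous (fun x => ∫ s in (0:ℝ)..x, u s) :=
  continuous_iff_continuousAt.2 fun r => (hasDerivAt_integral_zero hu r).continuousAt

lemma integral_zero_nonneg {u : ℝ → ℝ} (h0 : ∀ s, 0 ≤ s → 0 ≤ u s) {r : ℝ} (hr : 0 ≤ r) :
    0 ≤ ∫ s in (0:ℝ)..r, u s :=
  integral_nonneg hr fun s hs => h0 s hs.1

lemma integral_zero_div_le_one {u : ℝ → ℝ} (hu : Continuous u) (h0 : ∀ s, 0 ≤ s → 0 ≤ u s)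
    {r R : ℝ} (hr : 0 ≤ r) (hrR : r ≤ R) :
    (∫ s in (0:ℝ)..r, u s) / (∫ s in (0:ℝ)..R, u s) ≤ 1 := by
  have h1 := integral_add_adjacent_intervals (hu.intervalIntegrable (μ := volume) 0 r)
    (hu.intervalIntegrable r R)
  have h2 : 0 ≤ ∫ s in r..R, u s := integral_nonneg hrR fun s hs => h0 s (hr.trans hs.1)
  exact div_le_one_of_le₀ (by linarith) (integral_zero_nonneg h0 (hr.trans hrR))

lemma eberlePhi_pos (β a m r : ℝ) : 0 < eberlePhi β a m r := Real.exp_pos _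

lemma hasDerivAt_eberlePhi (β a m r : ℝ) :
    HasDerivAt (eberlePhi β a m)
      (eberlePhi β a m r * (-(β / 4) * max 0 (a - m * r))) r := by
  have hu : Continuous fun s : ℝ => max 0 (a - m * s) := by fun_prop
  exact ((hasDerivAt_integral_zero hu r).const_mul (-(β / 4))).exp

lemma continuous_eberlePhi (β a m : ℝ) : Continuous (eberlePhi β a m) :=
  continuous_iff_continuousAt.2 fun r => (hasDerivAt_eberlePhi β a m r).continuousAt

lemma continuous_eberlePhi_inv (β a m : ℝ) : Continuous fun s => (eberlePhi β a m s)⁻¹ :=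
  (continuous_eberlePhi β a m).inv₀ fun s => (eberlePhi_pos β a m s).ne'

lemma continuous_eberleRatio (β a m : ℝ) :
    Continuous fun s => eberleCapPhi β a m s / eberlePhi β a m s :=
  (continuous_integral_zero (continuous_eberlePhi β a m)).div (continuous_eberlePhi β a m)
    fun s => (eberlePhi_pos β a m s).ne'

lemma eberleCapPhi_nonneg (β a m : ℝ) {r : ℝ} (hr : 0 ≤ r) : 0 ≤ eberleCapPhi β a m r :=
  integral_zero_nonneg (fun s _ => (eberlePhi_pos β a m s).le) hr

lemma eberleRatio_nonneg (β a m : ℝ) {s : ℝ} (hs : 0 ≤ s) :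
    0 ≤ eberleCapPhi β a m s / eberlePhi β a m s :=
  div_nonneg (eberleCapPhi_nonneg β a m hs) (eberlePhi_pos β a m s).le

lemma eberleR1_nonneg {a m : ℝ} (hm : 0 ≤ m) (ha : 0 ≤ a) : 0 ≤ eberleR1 a m := by
  unfold eberleR1; positivity

lemma eberleIntRatio_nonneg (β : ℝ) {a m : ℝ} (hm : 0 ≤ m) (ha : 0 ≤ a) :
    0 ≤ eberleIntRatio β a m :=
  integral_zero_nonneg (fun _ => eberleRatio_nonneg β a m) (eberleR1_nonneg hm ha)

lemma continuous_eberleG (β a m : ℝ) : Continuous (eberleG β a m) := by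
  have hmin : Continuous fun r : ℝ => min r (eberleR1 a m) := by fun_prop
  have h1 := (continuous_integral_zero (continuous_eberleRatio β a m)).comp hmin
  have h2 := (continuous_integral_zero (continuous_eberlePhi_inv β a m)).comp hmin
  exact (continuous_const.sub ((continuous_const.mul h1).div_const _)).sub
    ((continuous_const.mul h2).div_const _)

lemma eberleG_mem_Icc (β a m : ℝ) {r : ℝ} (hr : 0 ≤ r) (hrR : r ≤ eberleR1 a m) :
    eberleG β a m r ∈ Set.Icc (1 / 2 : ℝ) 1 := by
  have hinv : ∀ s, 0 ≤ s → 0 ≤ (eberlePhi β a m s)⁻¹ :=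
    fun s _ => (inv_pos.2 (eberlePhi_pos β a m s)).le
  have hrat : ∀ s, 0 ≤ s → 0 ≤ eberleCapPhi β a m s / eberlePhi β a m s :=
    fun _ => eberleRatio_nonneg β a m
  have hR := hr.trans hrR
  have h1 := integral_zero_div_le_one (continuous_eberleRatio β a m) hrat hr hrR
  have h2 := integral_zero_div_le_one (continuous_eberlePhi_inv β a m) hinv hr hrR
  have h3 := div_nonneg (integral_zero_nonneg hrat hr) (integral_zero_nonneg hrat hR)
  have h4 := div_nonneg (integral_zero_nonneg hinv hr) (integral_zero_nonneg hinv hR)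
  simp only [eberleG, eberleIntRatio, eberleIntInv, min_eq_left hrR, mul_div_assoc, Set.mem_Icc]
  constructor <;> linarith

lemma hasDerivAt_eberleG (β a m : ℝ) {r : ℝ} (hrR : r < eberleR1 a m) :
    HasDerivAt (eberleG β a m)
      (-(1 / 4) * (eberleCapPhi β a m r / eberleIntRatio β a m + 1 / eberleIntInv β a m)
        / eberlePhi β a m r) r := by
  have h1 := ((hasDerivAt_integral_zero (continuous_eberleRatio β a m) r).const_mul
    (1 / 4)).div_const (eberleIntRatio β a m)
  have h2 := ((hasDerivAt_integral_zero (continuous_eberlePhi_inv β a m) r).const_mul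
    (1 / 4)).div_const (eberleIntInv β a m)
  have h := (h1.const_sub 1).sub h2
  refine (h.congr_of_eventuallyEq ?_).congr_deriv ?_
  · filter_upwards [Iio_mem_nhds hrR] with x hx
    simp only [eberleG, min_eq_left (Set.mem_Iio.1 hx).le, Pi.sub_apply]
  · ring

lemma continuous_eberlePhi_mul_eberleG (β a m : ℝ) :
    Continuous fun r => eberlePhi β a m r * eberleG β a m r :=
  (continuous_eberlePhi β a m).mul (continuous_eberleG β a m)

lemma hasDerivAt_eberleF (β a m r : ℝ) :
    HasDerivAt (eberleF β a m) (eberlePhi β a m r * eberleG β a m r) r :=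
  hasDerivAt_integral_zero (continuous_eberlePhi_mul_eberleG β a m) r

lemma deriv_eberleF (β a m : ℝ) :
    deriv (eberleF β a m) = fun r => eberlePhi β a m r * eberleG β a m r :=
  funext fun r => (hasDerivAt_eberleF β a m r).deriv

lemma hasDerivAt_deriv_eberleF (β a m : ℝ) {r : ℝ} (hrR : r < eberleR1 a m) :
    HasDerivAt (deriv (eberleF β a m))
      (-(β / 4) * max 0 (a - m * r) * (eberlePhi β a m r * eberleG β a m r)
        - (1 / 4) * (eberleCapPhi β a m r / eberleIntRatio β a m + 1 / eberleIntInv β a m)) r := by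
  rw [deriv_eberleF]
  refine ((hasDerivAt_eberlePhi β a m r).mul (hasDerivAt_eberleG β a m hrR)).congr_deriv ?_
  rw [mul_div_cancel₀ _ (eberlePhi_pos β a m r).ne']
  ring

lemma eberleF_le_eberleCapPhi (β a m : ℝ) {r : ℝ} (hr : 0 ≤ r) (hrR : r ≤ eberleR1 a m) :
    eberleF β a m r ≤ eberleCapPhi β a m r :=
  integral_mono_on hr ((continuous_eberlePhi_mul_eberleG β a m).intervalIntegrable _ _)
    ((continuous_eberlePhi β a m).intervalIntegrable _ _) fun s hs =>
      mul_le_of_le_one_right (eberlePhi_pos β a m s).le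
        (eberleG_mem_Icc β a m hs.1 (hs.2.trans hrR)).2

lemma eberleF_drift_le {β : ℝ} (a m : ℝ) (hβ : 0 < β) {r : ℝ} (hr : 0 ≤ r)
    (hrR : r < eberleR1 a m) :
    deriv (eberleF β a m) r * (a - m * r) + (4 / β) * deriv (deriv (eberleF β a m)) r ≤
      -(1 / β) * (eberleCapPhi β a m r / eberleIntRatio β a m + 1 / eberleIntInv β a m) := by
  rw [(hasDerivAt_deriv_eberleF β a m hrR).deriv, (hasDerivAt_eberleF β a m r).deriv]
  have hg : 0 ≤ eberlePhi β a m r * eberleG β a m r :=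
    mul_nonneg (eberlePhi_pos β a m r).le
      (le_trans (by norm_num) (eberleG_mem_Icc β a m hr hrR.le).1)
  have hmax := mul_le_mul_of_nonneg_left (le_max_right 0 (a - m * r)) hg
  generalize eberlePhi β a m r * eberleG β a m r = p at *
  generalize max 0 (a - m * r) = q at *
  generalize eberleCapPhi β a m r / eberleIntRatio β a m + 1 / eberleIntInv β a m = t
  have : (4 / β) * (-(β / 4) * q * p - 1 / 4 * t) = -(p * q) + -(1 / β) * t := by
    field_simp
    ring
  linarith

lemma eberleEps_add_eberleC_mul_eberleF_le {β a m : ℝ} (hm : 0 ≤ m) (hβ : 0 ≤ β) (ha : 0 ≤ a)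
    {r : ℝ} (hr : 0 ≤ r) (hrR : r ≤ eberleR1 a m) :
    eberleEps β a m + eberleC β a m * eberleF β a m r ≤
      (1 / β) * (eberleCapPhi β a m r / eberleIntRatio β a m + 1 / eberleIntInv β a m) := by
  have hI : 0 ≤ (eberleIntRatio β a m)⁻¹ := inv_nonneg.2 (eberleIntRatio_nonneg β hm ha)
  have heps : eberleEps β a m ≤ (β * eberleIntInv β a m)⁻¹ := min_le_right _ _
  have hC : eberleC β a m ≤ (1 / β) * (eberleIntRatio β a m)⁻¹ :=
    mul_le_mul_of_nonneg_right (min_le_left _ _) hI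
  have hC0 : 0 ≤ eberleC β a m := mul_nonneg (le_min (by positivity) (by norm_num)) hI
  calc eberleEps β a m + eberleC β a m * eberleF β a m r
      ≤ (β * eberleIntInv β a m)⁻¹
        + (1 / β) * (eberleIntRatio β a m)⁻¹ * eberleCapPhi β a m r :=
        add_le_add heps ((mul_le_mul_of_nonneg_left (eberleF_le_eberleCapPhi β a m hr hrR)
          hC0).trans (mul_le_mul_of_nonneg_right hC (eberleCapPhi_nonneg β a m hr)))
    _ = _ := by rw [mul_inv]; ring

/-- Near-field drift inequality for the Eberle distance function: `f` is `C¹` with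
`f' = φ g`, twice differentiable on `(0, R₁)`, and on `(0, R₁)`,
`f'(r)(a − m r) + (4/β) f''(r) ≤ −(1/β)[Φ(r)/∫₀^{R₁}Φ/φ + 1/∫₀^{R₁}φ⁻¹]`;
in particular `f'(r)(a − m r) + (4/β) f''(r) ≤ −(ε + c f(r))` on `(0, R₁)`. -/
theorem eberleF_near_field_drift (m β a : ℝ) (hm : 0 < m) (hβ : 0 < β) (ha : 0 ≤ a) :
    (∀ r : ℝ, HasDerivAt (eberleF β a m) (eberlePhi β a m r * eberleG β a m r) r) ∧
    Continuous (fun r => eberlePhi β a m r * eberleG β a m r) ∧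
    (∀ r ∈ Set.Ioo (0:ℝ) (eberleR1 a m),
      DifferentiableAt ℝ (deriv (eberleF β a m)) r) ∧
    (∀ r ∈ Set.Ioo (0:ℝ) (eberleR1 a m),
      deriv (eberleF β a m) r * (a - m * r)
          + (4 / β) * deriv (deriv (eberleF β a m)) r ≤
        -(1 / β) * (eberleCapPhi β a m r / eberleIntRatio β a m
          + 1 / eberleIntInv β a m)) ∧
    (∀ r ∈ Set.Ioo (0:ℝ) (eberleR1 a m),
      deriv (eberleF β a m) r * (a - m * r)
          + (4 / β) * deriv (deriv (eberleF β a m)) r ≤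
        -(eberleEps β a m + eberleC β a m * eberleF β a m r)) := by
  refine ⟨hasDerivAt_eberleF β a m, continuous_eberlePhi_mul_eberleG β a m,
    fun r hr => (hasDerivAt_deriv_eberleF β a m hr.2).differentiableAt,
    fun r hr => eberleF_drift_le a m hβ hr.1.le hr.2, fun r hr => ?_⟩
  have h1 := eberleF_drift_le a m hβ hr.1.le hr.2
  have h2 := eberleEps_add_eberleC_mul_eberleF_le hm.le hβ.le ha hr.1.le hr.2.le
  linarith
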